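/- arXiv:2105.12299 — 2 statements merged into one kernel-verified Lean document; each statement's English description precedes it below -/
import Mathlib

section
/- Let d ≥ 1 be a natural number, let ν be a real number with ν > 2d, and let V be a symmetric positive definite d×d real matrix. Then ∑_{i=1}^{d} ψ₁((ν - d - i)/2) > (2/(ν - d - 1)) · vec(V⁻¹)ᵀ · (V ⊗ V) · vec(V⁻¹), where ψ₁ is the trigamma function. -/
/-- The trigamma function, `ψ₁(x) = ∑_{n=0}^∞ 1/(x+n)²`. -/
noncomputable def trigamma (x : ℝ) : ℝ := ∑' n : ℕ, 1 / (x + n) ^ 2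

theorem hasSum_one_div_add_mul_add_one {x : ℝ} (hx : 0 < x) :
    HasSum (fun n : ℕ => 1 / ((x + n) * (x + n + 1))) (1 / x) := by
  rw [hasSum_iff_tendsto_nat_of_nonneg (fun n => by positivity)]
  have partial_sum (n : ℕ) :
      ∑ k ∈ Finset.range n, 1 / ((x + k) * (x + k + 1)) = 1 / x - 1 / (x + n) := by
    induction n with
    | zero => simp
    | succ n ih =>
      rw [Finset.sum_range_succ, ih]
      push_cast
      have : x + n ≠ 0 := by positivity
      have : x + n + 1 ≠ 0 := by positivity
      have : x + (n + 1) ≠ 0 := by positivity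
      field_simp
      ring
  simp only [partial_sum]
  have h : Filter.Tendsto (fun n : ℕ => x + (n : ℝ)) Filter.atTop Filter.atTop :=
    Filter.tendsto_atTop_add_const_left _ _ tendsto_natCast_atTop_atTop
  simpa using (h.inv_tendsto_atTop).const_sub (1 / x)

theorem summable_one_div_add_sq {x : ℝ} (hx : 0 < x) :
    Summable (fun n : ℕ => 1 / (x + n) ^ 2) := by
  refine ((Real.summable_one_div_nat_add_rpow x 2).2 one_lt_two).congr fun n => ?_
  rw [abs_of_pos (by positivity), add_comm, Real.rpow_two]

theorem one_div_lt_trigamma {x : ℝ} (hx : 0 < x) : 1 / x < trigamma x := by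
  have hs := hasSum_one_div_add_mul_add_one hx
  have term_lt (n : ℕ) : 1 / ((x + n) * (x + n + 1)) < 1 / (x + n) ^ 2 := by
    have : 0 < x + n := by positivity
    apply one_div_lt_one_div_of_lt (by positivity)
    nlinarith
  rw [← hs.tsum_eq]
  exact hs.summable.tsum_lt_tsum (fun n => (term_lt n).le) (term_lt 0)
    (summable_one_div_add_sq hx)

/-- For invertible `V`, the form `vec(V⁻¹)ᵀ (V ⊗ V) vec(V⁻¹)` is the dimension. -/
theorem vec_inv_kronecker_vec_inv {n : Type*} [Fintype n] [DecidableEq n]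
    {V : Matrix n n ℝ} (hdet : IsUnit V.det) :
    ∑ p : n × n, ∑ q : n × n,
      V⁻¹ p.2 p.1 * (V p.1 q.1 * V p.2 q.2) * V⁻¹ q.2 q.1 = Fintype.card n := by
  calc
    _ = ∑ j, ∑ k, (V⁻¹ * V) j k * (V * V⁻¹) j k := by
      simp only [Fintype.sum_prod_type, Matrix.mul_apply, Finset.sum_mul_sum]
      rw [Finset.sum_comm]
      refine Finset.sum_congr rfl fun j _ => ?_
      rw [Finset.sum_comm]
      refine Finset.sum_congr rfl fun k _ => Finset.sum_congr rfl fun i _ =>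
        Finset.sum_congr rfl fun l _ => by ring
    _ = Fintype.card n := by
      simp [Matrix.nonsing_inv_mul V hdet, Matrix.mul_nonsing_inv V hdet, Matrix.one_apply]

/-- **Corollary 1.** For `d ≥ 1`, `ν > 2d`, and `V` symmetric positive definite,
`∑_{i=1}^{d} ψ₁((ν - d - i)/2) > (2/(ν - d - 1)) · vec(V⁻¹)ᵀ (V ⊗ V) vec(V⁻¹)`,
where `vec(A)_{(i,j)} = A_{j,i}` and `(V ⊗ V)_{(i,j),(k,l)} = V_{i,k} · V_{j,l}`. -/
theorem trigamma_sum_gt_quadratic_form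
    (d : ℕ) (hd : 1 ≤ d) (ν : ℝ) (hν : ν > 2 * d)
    (V : Matrix (Fin d) (Fin d) ℝ) (hV : V.PosDef) :
    ∑ i ∈ Finset.Icc 1 d, trigamma ((ν - d - i) / 2) >
      (2 / (ν - d - 1)) *
        ∑ p : Fin d × Fin d, ∑ q : Fin d × Fin d,
          V⁻¹ p.2 p.1 * (V p.1 q.1 * V p.2 q.2) * V⁻¹ q.2 q.1 := by
  rw [vec_inv_kronecker_vec_inv hV.det_pos.ne'.isUnit, Fintype.card_fin, gt_iff_lt]
  have hsum : 2 / (ν - d - 1) * d = ∑ _i ∈ Finset.Icc 1 d, 2 / (ν - d - 1) := by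
    simp [mul_comm]
  rw [hsum]
  refine Finset.sum_lt_sum_of_nonempty (Finset.nonempty_Icc.2 hd) fun i hi => ?_
  obtain ⟨h1, h2⟩ := Finset.mem_Icc.1 hi
  have h1' : (1 : ℝ) ≤ i := by exact_mod_cast h1
  have h2' : (i : ℝ) ≤ d := by exact_mod_cast h2
  have hpos : 0 < ν - d - i := by linarith
  calc 2 / (ν - d - 1) ≤ 2 / (ν - d - i) := by gcongr
    _ = 1 / ((ν - d - i) / 2) := by rw [one_div_div]
    _ < trigamma ((ν - d - i) / 2) := one_div_lt_trigamma (by positivity)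
end

section
/- Let d ≥ 1 be a natural number, let c be a real number, and let E be a symmetric positive definite d×d real matrix. Define S = {(ν, V) : ν ∈ ℝ, ν > 2d, V a symmetric positive definite d×d real matrix} and f(ν, V) = ((ν - d - 1)/2)·(log det V - d·log 2) - (ν/2)·c - (1/2)·tr(V·E) - log Γ_d((ν - d - 1)/2). Suppose (ν*, V*) ∈ S satisfies the stationarity conditions V* = (ν* - d - 1)·E⁻¹ and log det V* = d·log 2 + c + ∑_{i=1}^{d} ψ₀((ν* - d - i)/2). Then (ν*, V*) is the unique global maximiser of f on S; that is, for every (ν, V) ∈ S with (ν, V) ≠ (ν*, V*), f(ν, V) < f(ν*, V*). -/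
/-- The multivariate gamma function
`Γ_d(a) = π^{d(d-1)/4} · ∏_{i=1}^{d} Γ(a - (i-1)/2)`. -/
noncomputable def mvGamma (d : ℕ) (a : ℝ) : ℝ :=
  Real.pi ^ ((d : ℝ) * ((d : ℝ) - 1) / 4) *
    ∏ i ∈ Finset.Icc 1 d, Real.Gamma (a - ((i : ℝ) - 1) / 2)

/-- The digamma function, the derivative of `x ↦ log Γ(x)`. -/
noncomputable def digamma (x : ℝ) : ℝ :=
  deriv (fun y : ℝ => Real.log (Real.Gamma y)) x

/-- The Bregman divergence of `x ↦ x log x` on `(0, ∞)`, based at `x`. -/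
noncomputable def mulLogGap (x y : ℝ) : ℝ :=
  y * Real.log (y / x) - (y - x)

/-- The Bregman divergence of `log Γ` on `(0, ∞)`, based at `x`. -/
noncomputable def logGammaGap (x y : ℝ) : ℝ :=
  Real.log (Real.Gamma y) - Real.log (Real.Gamma x) - digamma x * (y - x)

lemma mulLogGap_le_sq_div {x y : ℝ} (hx : 0 < x) (hy : 0 < y) :
    mulLogGap x y ≤ (y - x) ^ 2 / x := by
  have h := mul_le_mul_of_nonneg_left (Real.log_le_sub_one_of_pos (div_pos hy hx)) hy.le
  have e : y * (y / x - 1) - (y - x) = (y - x) ^ 2 / x := by field_simp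
  unfold mulLogGap
  linarith

lemma mulLogGap_add_le {x y s : ℝ} (hx : 0 < x) (hy : 0 < y) (hs : 0 ≤ s) :
    mulLogGap (x + s) (y + s) ≤ mulLogGap x y := by
  have hxs : 0 < x + s := by linarith
  have hys : 0 < y + s := by linarith
  have h₁ := mul_le_mul_of_nonneg_left
    (Real.log_le_sub_one_of_pos (div_pos (div_pos hys hxs) (div_pos hy hx))) hy.le
  have h₂ := mul_le_mul_of_nonneg_left
    (Real.log_le_sub_one_of_pos (div_pos hys hxs)) hs
  rw [Real.log_div (div_pos hys hxs).ne' (div_pos hy hx).ne'] at h₁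
  have e : y * ((y + s) / (x + s) / (y / x) - 1) + s * ((y + s) / (x + s) - 1) = 0 := by
    field_simp
    ring
  unfold mulLogGap
  linarith

lemma mulLogGap_lt_add_one {x y : ℝ} (hx : 0 < x) (hy : 0 < y) (hxy : y ≠ x) :
    mulLogGap x y < mulLogGap (x + 1) (y + 1) + ((y - x) / x - Real.log (y / x)) := by
  have hx1 : 0 < x + 1 := by linarith
  have hy1 : 0 < y + 1 := by linarith
  have hne : y / x / ((y + 1) / (x + 1)) ≠ 1 := by
    intro h
    field_simp at h
    exact hxy (by linarith)
  have h := mul_lt_mul_of_pos_left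
    (Real.log_lt_sub_one_of_pos (div_pos (div_pos hy hx) (div_pos hy1 hx1)) hne) hy1
  rw [Real.log_div (div_pos hy hx).ne' (div_pos hy1 hx1).ne'] at h
  have e : (y + 1) * (y / x / ((y + 1) / (x + 1)) - 1) = (y - x) / x := by
    field_simp
    ring
  unfold mulLogGap
  linarith

lemma hasDerivAt_log_Gamma {x : ℝ} (hx : 0 < x) :
    HasDerivAt (fun y : ℝ => Real.log (Real.Gamma y)) (digamma x) x := by
  refine DifferentiableAt.hasDerivAt ?_
  refine (Real.differentiableAt_Gamma fun m => ?_).log (Real.Gamma_pos_of_pos hx).ne'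
  have : (0 : ℝ) ≤ m := m.cast_nonneg
  linarith

lemma log_Gamma_add_one {x : ℝ} (hx : 0 < x) :
    Real.log (Real.Gamma (x + 1)) = Real.log x + Real.log (Real.Gamma x) := by
  rw [Real.Gamma_add_one hx.ne', Real.log_mul hx.ne' (Real.Gamma_pos_of_pos hx).ne']

lemma digamma_add_one {x : ℝ} (hx : 0 < x) : digamma (x + 1) = digamma x + x⁻¹ := by
  have h₁ : HasDerivAt (fun y : ℝ => Real.log (Real.Gamma (y + 1))) (digamma (x + 1)) x :=
    (hasDerivAt_log_Gamma (by linarith : 0 < x + 1)).comp_add_const x 1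
  have h₂ := (Real.hasDerivAt_log hx.ne').add (hasDerivAt_log_Gamma hx)
  rw [add_comm (digamma x)]
  refine h₁.unique (h₂.congr_of_eventuallyEq ?_)
  filter_upwards [lt_mem_nhds hx] with y hy
  exact log_Gamma_add_one hy

lemma logGammaGap_eq_add_one {x y : ℝ} (hx : 0 < x) (hy : 0 < y) :
    logGammaGap x y =
      logGammaGap (x + 1) (y + 1) + ((y - x) / x - Real.log (y / x)) := by
  unfold logGammaGap
  rw [log_Gamma_add_one hx, log_Gamma_add_one hy, digamma_add_one hx,
    Real.log_div hy.ne' hx.ne', div_eq_mul_inv]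
  ring

lemma logGammaGap_nonneg {x y : ℝ} (hx : 0 < x) (hy : 0 < y) : 0 ≤ logGammaGap x y := by
  have hd := hasDerivAt_log_Gamma hx
  unfold logGammaGap
  rcases lt_trichotomy x y with h | rfl | h
  · have := Real.convexOn_log_Gamma.le_slope_of_hasDerivAt hx hy h hd
    rw [slope_def_field, le_div_iff₀ (sub_pos.2 h)] at this
    simp only [Function.comp_apply] at this
    linarith
  · simp
  · have := Real.convexOn_log_Gamma.slope_le_of_hasDerivAt hy hx h hd
    rw [slope_def_field, div_le_iff₀ (sub_pos.2 h)] at this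
    simp only [Function.comp_apply] at this
    linarith

lemma logGammaGap_sub_mulLogGap_add_nat_le {x y : ℝ} (hx : 0 < x) (hy : 0 < y) (hxy : y ≠ x)
    (n : ℕ) :
    logGammaGap (x + n) (y + n) - mulLogGap (x + n) (y + n) ≤
      logGammaGap x y - mulLogGap x y := by
  induction n with
  | zero => simp
  | succ n ih =>
    have hxn : 0 < x + n := by positivity
    have hyn : 0 < y + n := by positivity
    have h₁ := mulLogGap_lt_add_one hxn hyn (by simpa using hxy)
    have h₂ := logGammaGap_eq_add_one hxn hyn
    push_cast
    rw [← add_assoc, ← add_assoc]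
    linarith

lemma mulLogGap_le_logGammaGap {x y : ℝ} (hx : 0 < x) (hy : 0 < y) (hxy : y ≠ x) :
    mulLogGap x y ≤ logGammaGap x y := by
  have hlim : Filter.Tendsto (fun n : ℕ => -((y - x) ^ 2 / (x + n))) Filter.atTop (nhds 0) := by
    rw [← neg_zero]
    exact (Filter.Tendsto.const_div_atTop
      (Filter.tendsto_atTop_add_const_left _ x tendsto_natCast_atTop_atTop) _).neg
  refine sub_nonneg.1 (le_of_tendsto' hlim fun n => ?_)
  have hxn : 0 < x + n := by positivity
  have hyn : 0 < y + n := by positivity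
  have h₁ := logGammaGap_sub_mulLogGap_add_nat_le hx hy hxy n
  have h₂ := logGammaGap_nonneg hxn hyn
  have h₃ := mulLogGap_le_sq_div hxn hyn
  rw [add_sub_add_right_eq_sub] at h₃
  linarith

/-- `x ↦ log Γ(x) - x log x` lies strictly above its tangents on `(0, ∞)`. -/
lemma mulLogGap_lt_logGammaGap {x y : ℝ} (hx : 0 < x) (hy : 0 < y) (hxy : y ≠ x) :
    mulLogGap x y < logGammaGap x y := by
  have h₁ := mulLogGap_lt_add_one hx hy hxy
  have h₂ := logGammaGap_eq_add_one hx hy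
  have h₃ := mulLogGap_le_logGammaGap (by linarith : 0 < x + 1) (by linarith : 0 < y + 1)
    (by simpa using hxy)
  linarith

namespace Matrix

variable {n : Type*} [Fintype n] [DecidableEq n]

lemma PosDef.log_det_eq_sum {M : Matrix n n ℝ} (hM : M.PosDef) :
    Real.log M.det = ∑ i, Real.log (hM.1.eigenvalues i) := by
  rw [hM.1.det_eq_prod_eigenvalues]
  exact Real.log_prod fun i _ => (hM.eigenvalues_pos i).ne'

lemma PosDef.trace_sub_card_eq_sum {M : Matrix n n ℝ} (hM : M.PosDef) :
    M.trace - Fintype.card n = ∑ i, (hM.1.eigenvalues i - 1) := by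
  rw [hM.1.trace_eq_sum_eigenvalues]
  simp

lemma PosDef.log_det_lt_trace_sub_card {M : Matrix n n ℝ} (hM : M.PosDef) (h1 : M ≠ 1) :
    Real.log M.det < M.trace - Fintype.card n := by
  rw [hM.log_det_eq_sum, hM.trace_sub_card_eq_sum]
  obtain ⟨i, hi⟩ : ∃ i, hM.1.eigenvalues i ≠ 1 := by
    by_contra! h
    refine h1 ?_
    have he : (RCLike.ofReal ∘ hM.1.eigenvalues : n → ℝ) = fun _ => 1 := by
      ext i
      simp [h i]
    rw [hM.1.spectral_theorem, he, Matrix.diagonal_one, map_one]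
  exact Finset.sum_lt_sum (fun j _ => Real.log_le_sub_one_of_pos (hM.eigenvalues_pos j))
    ⟨i, Finset.mem_univ i, Real.log_lt_sub_one_of_pos (hM.eigenvalues_pos i) hi⟩

open scoped MatrixOrder in
/-- Strict concavity of `log det`, as a tangent inequality at `E⁻¹`. -/
lemma PosDef.log_det_add_log_det_lt {V E : Matrix n n ℝ} (hV : V.PosDef) (hE : E.PosDef)
    (hne : V ≠ E⁻¹) :
    Real.log V.det + Real.log E.det < (V * E).trace - Fintype.card n := by
  obtain ⟨B, hB⟩ := CStarAlgebra.nonneg_iff_eq_star_mul_self.mp hE.posSemidef.nonneg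
  have hBu : IsUnit B := by
    have h := hE.isUnit
    rw [hB] at h
    exact isUnit_of_mul_isUnit_right h
  have hM : (B * V * star B).PosDef := (IsUnit.posDef_star_right_conjugate_iff hBu).2 hV
  have hdet : (B * V * star B).det = V.det * E.det := by
    rw [hB, det_mul, det_mul, det_mul]
    ring
  have htr : (B * V * star B).trace = (V * E).trace := by
    rw [hB, trace_mul_comm, ← mul_assoc, trace_mul_comm]
  have h1 : B * V * star B ≠ 1 := by
    intro h
    refine hne (inv_eq_left_inv ?_).symm
    rw [mul_assoc] at h
    have h' := mul_eq_one_comm.1 h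
    rw [hB, ← mul_assoc]
    rwa [mul_assoc] at h' ⊢
  have := hM.log_det_lt_trace_sub_card h1
  rwa [hdet, htr, Real.log_mul hV.det_pos.ne' hE.det_pos.ne'] at this

lemma PosDef.log_det_smul {M : Matrix n n ℝ} (hM : M.PosDef) {t : ℝ} (ht : 0 < t) :
    Real.log (t • M).det = Fintype.card n * Real.log t + Real.log M.det := by
  rw [det_smul, Real.log_mul (pow_pos ht _).ne' hM.det_pos.ne', Real.log_pow]

lemma PosDef.log_det_lt_of_ne_smul_inv {V E : Matrix n n ℝ} (hV : V.PosDef) (hE : E.PosDef)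
    {t : ℝ} (ht : 0 < t) (hne : V ≠ t • E⁻¹) :
    t * Real.log V.det - (V * E).trace <
      t * (Fintype.card n * Real.log t - Real.log E.det) - t * Fintype.card n := by
  have hinv : (t⁻¹ • E)⁻¹ = t • E⁻¹ := by
    refine inv_eq_left_inv ?_
    rw [smul_mul_smul_comm, nonsing_inv_mul _ hE.det_pos.ne'.isUnit, mul_inv_cancel₀ ht.ne',
      one_smul]
  have h := hV.log_det_add_log_det_lt (hE.smul (inv_pos.2 ht)) (hinv ▸ hne)
  rw [hE.log_det_smul (inv_pos.2 ht), Real.log_inv, mul_smul_comm, trace_smul, smul_eq_mul] at h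
  have h' := mul_lt_mul_of_pos_left h ht
  rw [mul_sub, ← mul_assoc t t⁻¹, mul_inv_cancel₀ ht.ne', one_mul] at h'
  linarith

lemma PosDef.smul_inv_mul_self_trace {E : Matrix n n ℝ} (hE : E.PosDef) (t : ℝ) :
    ((t • E⁻¹) * E).trace = t * Fintype.card n := by
  rw [smul_mul_assoc, nonsing_inv_mul _ hE.det_pos.ne'.isUnit, trace_smul, trace_one, smul_eq_mul]

lemma PosDef.log_det_smul_inv {E : Matrix n n ℝ} (hE : E.PosDef) {t : ℝ} (ht : 0 < t) :
    Real.log (t • E⁻¹).det = Fintype.card n * Real.log t - Real.log E.det := by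
  rw [hE.inv.log_det_smul ht, det_nonsing_inv, Ring.inverse_eq_inv', Real.log_inv]
  ring

end Matrix

lemma log_mvGamma {d : ℕ} {a : ℝ} (ha : ((d : ℝ) - 1) / 2 < a) :
    Real.log (mvGamma d a) =
      Real.log (Real.pi ^ ((d : ℝ) * ((d : ℝ) - 1) / 4)) +
        ∑ i ∈ Finset.Icc 1 d, Real.log (Real.Gamma (a - ((i : ℝ) - 1) / 2)) := by
  have hpos : ∀ i ∈ Finset.Icc 1 d, Real.Gamma (a - ((i : ℝ) - 1) / 2) ≠ 0 := by
    intro i hi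
    have : (i : ℝ) ≤ d := by exact_mod_cast (Finset.mem_Icc.1 hi).2
    exact (Real.Gamma_pos_of_pos (by linarith)).ne'
  rw [mvGamma, Real.log_mul (Real.rpow_pos_of_pos Real.pi_pos _).ne'
      (Finset.prod_ne_zero_iff.2 hpos),
    Real.log_prod hpos]

/-- `log Γ_d(a) - d a log a` lies strictly above its tangents. -/
lemma card_mul_mulLogGap_lt {d : ℕ} (hd : 1 ≤ d) {a b : ℝ} (ha : ((d : ℝ) - 1) / 2 < a)
    (hb : ((d : ℝ) - 1) / 2 < b) (hab : b ≠ a) :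
    d * mulLogGap a b <
      Real.log (mvGamma d b) - Real.log (mvGamma d a) -
        (∑ i ∈ Finset.Icc 1 d, digamma (a - ((i : ℝ) - 1) / 2)) * (b - a) := by
  have hterm : ∀ i ∈ Finset.Icc 1 d, mulLogGap a b <
      logGammaGap (a - ((i : ℝ) - 1) / 2) (b - ((i : ℝ) - 1) / 2) := by
    intro i hi
    have h1 : (1 : ℝ) ≤ i := by exact_mod_cast (Finset.mem_Icc.1 hi).1
    have h2 : (i : ℝ) ≤ d := by exact_mod_cast (Finset.mem_Icc.1 hi).2
    have hx : 0 < a - ((i : ℝ) - 1) / 2 := by linarith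
    have hy : 0 < b - ((i : ℝ) - 1) / 2 := by linarith
    have h := mulLogGap_add_le hx hy (by linarith : 0 ≤ ((i : ℝ) - 1) / 2)
    rw [sub_add_cancel, sub_add_cancel] at h
    exact h.trans_lt (mulLogGap_lt_logGammaGap hx hy (by simpa using hab))
  have hsum := Finset.sum_lt_sum_of_nonempty (Finset.nonempty_Icc.2 hd) hterm
  have hgap : ∑ i ∈ Finset.Icc 1 d,
      logGammaGap (a - ((i : ℝ) - 1) / 2) (b - ((i : ℝ) - 1) / 2) =
      Real.log (mvGamma d b) - Real.log (mvGamma d a) -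
        (∑ i ∈ Finset.Icc 1 d, digamma (a - ((i : ℝ) - 1) / 2)) * (b - a) := by
    simp only [logGammaGap, sub_sub_sub_cancel_right, Finset.sum_sub_distrib, Finset.sum_mul,
      log_mvGamma ha, log_mvGamma hb]
    ring
  rw [hgap] at hsum
  simpa using hsum

/-- **Lemma 2 (unique global maximiser).** A stationary point `(ν*, V*)`
of the Kullback-Leibler objective `f` on
`S = {(ν, V) : ν > 2d, V symmetric positive definite}`, i.e. one satisfying
`V* = (ν* - d - 1)·E⁻¹` and
`log det V* = d log 2 + c + ∑_{i=1}^d ψ₀((ν* - d - i)/2)`,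
is the unique global maximiser of `f` on `S`. -/
theorem kl_objective_unique_max
    (d : ℕ) (hd : 1 ≤ d) (c : ℝ)
    (E : Matrix (Fin d) (Fin d) ℝ) (hE : E.PosDef)
    (f : ℝ × Matrix (Fin d) (Fin d) ℝ → ℝ)
    (hf : f = fun p : ℝ × Matrix (Fin d) (Fin d) ℝ =>
      ((p.1 - d - 1) / 2) * (Real.log p.2.det - d * Real.log 2) -
        (p.1 / 2) * c - (1 / 2) * (p.2 * E).trace -
        Real.log (mvGamma d ((p.1 - d - 1) / 2)))
    (νs : ℝ) (Vs : Matrix (Fin d) (Fin d) ℝ)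
    (hmem : 2 * d < νs ∧ Vs.PosDef)
    (hstatV : Vs = (νs - d - 1) • E⁻¹)
    (hstatν : Real.log Vs.det =
      d * Real.log 2 + c + ∑ i ∈ Finset.Icc 1 d, digamma ((νs - d - i) / 2)) :
    ∀ p : ℝ × Matrix (Fin d) (Fin d) ℝ,
      (2 * d < p.1 ∧ p.2.PosDef) → p ≠ (νs, Vs) → f p < f (νs, Vs) := by
  rintro ⟨ν, V⟩ ⟨hν, hV⟩ hne
  obtain ⟨hνs, -⟩ := hmem
  have hd' : (1 : ℝ) ≤ d := by exact_mod_cast hd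
  dsimp only at hν hV
  obtain ⟨b, rfl⟩ : ∃ b, ν = 2 * b + d + 1 := ⟨(ν - d - 1) / 2, by ring⟩
  obtain ⟨a, rfl⟩ : ∃ a, νs = 2 * a + d + 1 := ⟨(νs - d - 1) / 2, by ring⟩
  have ha : ((d : ℝ) - 1) / 2 < a := by linarith
  have hb : ((d : ℝ) - 1) / 2 < b := by linarith
  have ha0 : 0 < a := by linarith
  have hb0 : 0 < b := by linarith
  have hsub : ∀ t : ℝ, 2 * t + d + 1 - d - 1 = 2 * t := fun t => by ring
  have hhalf : ∀ t : ℝ, 2 * t / 2 = t := fun t => by ring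
  rw [hsub] at hstatV
  have hdig : ∑ i ∈ Finset.Icc 1 d, digamma ((2 * a + d + 1 - d - i) / 2) =
      ∑ i ∈ Finset.Icc 1 d, digamma (a - ((i : ℝ) - 1) / 2) :=
    Finset.sum_congr rfl fun i _ => by congr 1; ring
  have hlog : ∀ t : ℝ, 0 < t → Real.log (2 * t) = Real.log 2 + Real.log t := fun t ht =>
    Real.log_mul two_ne_zero ht.ne'
  have htrs := hE.smul_inv_mul_self_trace (2 * a)
  have hdets := hE.log_det_smul_inv (by linarith : 0 < 2 * a)
  rw [← hstatV, Fintype.card_fin] at htrs hdets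
  rw [hdig, hdets, hlog a ha0] at hstatν
  rw [hlog a ha0] at hdets
  subst hf
  simp only [hsub, hhalf, htrs, hdets]
  by_cases hab : b = a
  · subst hab
    have hVne : V ≠ (2 * b) • E⁻¹ := fun h => hne (by rw [h, ← hstatV])
    have h := hV.log_det_lt_of_ne_smul_inv hE (by linarith : 0 < 2 * b) hVne
    rw [Fintype.card_fin, hlog b hb0] at h
    linarith
  · have hVle : 2 * b * Real.log V.det - (V * E).trace ≤
        2 * b * (d * Real.log (2 * b) - Real.log E.det) - 2 * b * d := by
      by_cases hVe : V = (2 * b) • E⁻¹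
      · rw [hVe, hE.log_det_smul_inv (by linarith : 0 < 2 * b), hE.smul_inv_mul_self_trace,
          Fintype.card_fin]
      · simpa using (hV.log_det_lt_of_ne_smul_inv hE (by linarith : 0 < 2 * b) hVe).le
    rw [hlog b hb0] at hVle
    have hgap := card_mul_mulLogGap_lt hd ha hb hab
    rw [mulLogGap, Real.log_div hb0.ne' ha0.ne'] at hgap
    set Ψ := ∑ i ∈ Finset.Icc 1 d, digamma (a - ((i : ℝ) - 1) / 2)
    have hΨ : Ψ = d * Real.log a - Real.log E.det - c := by linarith
    rw [hΨ] at hgap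
    linarith
end
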